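/- In the Setup, for every x ∈ X: the sum Σ_P c_P(π_P(x)) over all pieces P has only finitely many nonzero terms, a geodesic γ from x̂ to x has only finitely many long pieces, and the value c*_X(x) does not depend on the choice of the geodesic γ from x̂ to x. -/

import Mathlib

open Set Metric

section Core

variable {X : Type*} [MetricSpace X]

/-- A geodesic segment parametrized by the interval `[a, b]`:
an isometric embedding of `[a, b]` into `X`. -/
def IsGeodesicSegment (γ : ℝ → X) (a b : ℝ) : Prop :=
  ∀ s ∈ Set.Icc a b, ∀ t ∈ Set.Icc a b, dist (γ s) (γ t) = |s - t|

/-- A metric space is geodesic if every two points are joined by a geodesic. -/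
def GeodesicSpace (X : Type*) [MetricSpace X] : Prop :=
  ∀ x y : X, ∃ γ : ℝ → X, IsGeodesicSegment γ 0 (dist x y) ∧ γ 0 = x ∧ γ (dist x y) = y

/-- A subset is geodesic if every two of its points are joined by a geodesic of `X`
contained in the subset. -/
def IsGeodesicSubset (S : Set X) : Prop :=
  ∀ x ∈ S, ∀ y ∈ S, ∃ γ : ℝ → X, IsGeodesicSegment γ 0 (dist x y) ∧ γ 0 = x ∧
    γ (dist x y) = y ∧ ∀ t ∈ Set.Icc (0 : ℝ) (dist x y), γ t ∈ S

/-- A (complete geodesic) metric space is tree-graded with respect to a collection `PX`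
of closed geodesic subsets (pieces) covering `X` if every two different pieces meet in
at most one point (T₁) and every simple loop (injective continuous image of a circle)
is contained in one piece (T₂''). -/
structure IsTreeGraded (X : Type*) [MetricSpace X] (PX : Set (Set X)) : Prop where
  nonempty : ∀ P ∈ PX, P.Nonempty
  closed : ∀ P ∈ PX, IsClosed P
  geodesicSub : ∀ P ∈ PX, IsGeodesicSubset P
  covers : ∀ x : X, ∃ P ∈ PX, x ∈ P
  t1 : ∀ P ∈ PX, ∀ Q ∈ PX, P ≠ Q → (P ∩ Q).Subsingleton
  t2 : ∀ loop : AddCircle (1 : ℝ) → X, Continuous loop → Function.Injective loop →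
    ∃ P ∈ PX, Set.range loop ⊆ P

end Core
section Chains

variable {Y : Type*}

/-- An `r`-chain from `x` to `y` inside the set `S`, with respect to the distance
function `d`: a finite sequence `x = c 0, c 1, …, c m = y` of points of `S` with
consecutive distances `< r`. -/
def IsDChain (d : Y → Y → ℝ) (r : ℝ) (S : Set Y) (x y : Y) : Prop :=
  ∃ (m : ℕ) (c : ℕ → Y), c 0 = x ∧ c m = y ∧ (∀ i ≤ m, c i ∈ S) ∧
    ∀ i < m, d (c i) (c (i + 1)) < r

/-- A set is `r`-scale connected if every two of its points are joined by an
`r`-chain contained in it. -/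
def DScaleConnected (d : Y → Y → ℝ) (r : ℝ) (S : Set Y) : Prop :=
  ∀ x ∈ S, ∀ y ∈ S, IsDChain d r S x y

/-- `C` is an `r`-scale connected component of `U`: a maximal `r`-scale connected
subset of `U`. -/
def IsDComponent (d : Y → Y → ℝ) (r : ℝ) (U C : Set Y) : Prop :=
  C ⊆ U ∧ DScaleConnected d r C ∧
    ∀ C', C ⊆ C' → C' ⊆ U → DScaleConnected d r C' → C = C'

/-- A set is `M`-bounded: its diameter is at most `M`. -/
def DBounded (d : Y → Y → ℝ) (M : ℝ) (S : Set Y) : Prop :=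
  ∀ x ∈ S, ∀ y ∈ S, d x y ≤ M

/-- A space has dimension `≤ n` at scale `s` of magnitude `M` if there is a cover by
`n + 1` sets such that every `s`-scale connected component of each of them is
`M`-bounded. -/
def DimLeAtScale (d : Y → Y → ℝ) (n : ℕ) (s M : ℝ) : Prop :=
  ∃ U : Fin (n + 1) → Set Y, (∀ y, ∃ i, y ∈ U i) ∧
    ∀ i C, IsDComponent d s (U i) C → DBounded d M C

end Chains
section TreeGradedColoring

variable {X : Type*} [MetricSpace X]

/-- The `r`-scale connected component `𝔠_P` of `c_P`-color `0` of the piece `P`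
containing its base point `x_P = proj P x̂`: the set of points of `P` reachable from
`x_P` by an `r`-chain of points of `P` of `c_P`-color `0`. -/
def pieceComp (r : ℝ) {n : ℕ} (xhat : X) (proj : Set X → X → X)
    (cP : Set X → X → Fin (n + 1)) (P : Set X) : Set X :=
  {y | IsDChain dist r {z | z ∈ P ∧ cP P z = 0} (proj P xhat) y}

/-- `P` is a long piece of the geodesic `γ : [0, L] → X` (from `x̂` to `x = γ L`):
`γ` meets `P` and the exit point `π_P x` does not belong to `𝔠_P`. -/
def IsLongPiece (PX : Set (Set X)) (r : ℝ) {n : ℕ} (xhat : X)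
    (proj : Set X → X → X) (cP : Set X → X → Fin (n + 1))
    (γ : ℝ → X) (L : ℝ) (P : Set X) : Prop :=
  P ∈ PX ∧ (∃ t ∈ Set.Icc 0 L, γ t ∈ P) ∧
    proj P (γ L) ∉ pieceComp r xhat proj cP P

/-- The parameter at which the geodesic `γ : [0, L] → X` enters the piece `P`. -/
noncomputable def pieceStart (γ : ℝ → X) (L : ℝ) (P : Set X) : ℝ :=
  sInf {t | t ∈ Set.Icc 0 L ∧ γ t ∈ P}

/-- The parameter at which the geodesic `γ : [0, L] → X` exits the piece `P`. -/
noncomputable def pieceEnd (γ : ℝ → X) (L : ℝ) (P : Set X) : ℝ :=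
  sSup {t | t ∈ Set.Icc 0 L ∧ γ t ∈ P}

/-- The complement in `γ : [0, L] → X` (in parameter space) of the interiors of all
reduced long pieces of `γ`; its connected components are the subpaths `β₁, …, β_k`. -/
noncomputable def betaSet (PX : Set (Set X)) (r : ℝ) {n : ℕ} (xhat : X)
    (proj : Set X → X → X) (cP : Set X → X → Fin (n + 1))
    (γ : ℝ → X) (L : ℝ) : Set ℝ :=
  Set.Icc 0 L \
    ⋃ P ∈ {P | IsLongPiece PX r xhat proj cP γ L P},
      Set.Ioo (pieceStart γ L P + r / 2) (pieceEnd γ L P)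

/-- The length `|⌊β⌋|` of the initial part of the subpath `β = γ|[a,b]`, where
`⌊β⌋` goes from `β₋ = γ a` to the entry point `β′` of the piece of the induced
tree-graded structure on `β` containing `β₊ = γ b`. -/
noncomputable def floorLen (PX : Set (Set X)) (γ : ℝ → X) (a b : ℝ) : ℝ :=
  sInf {t | t ∈ Set.Icc a b ∧ ∃ P ∈ PX, γ '' Set.Icc t b ⊆ P} - a

/-- `v` is the value at `x = γ L` of the coloring `c*_X` computed along the geodesic
`γ : [0, L] → X` from `x̂` to `x`:
`v = Σ_P c_P(π_P x) + Σᵢ ⌊ |⌊βᵢ⌋| / (99 f(r)) ⌋ (mod n+1)`,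
where the first sum is over the (finitely many) pieces with a nonzero term and
`β₁, …, β_k` are the connected components of the complement in `γ` of the interiors
of the reduced long pieces of `γ`. -/
def ColorValue (PX : Set (Set X)) (r fr : ℝ) {n : ℕ} (xhat : X)
    (proj : Set X → X → X) (cP : Set X → X → Fin (n + 1))
    (γ : ℝ → X) (L : ℝ) (v : Fin (n + 1)) : Prop :=
  ∃ (Ps : Finset (Set X)) (k : ℕ) (a b : Fin k → ℝ),
    (↑Ps : Set (Set X)) = {P | P ∈ PX ∧ cP P (proj P (γ L)) ≠ 0} ∧
    (∀ i, a i ≤ b i) ∧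
    (betaSet PX r xhat proj cP γ L = ⋃ i, Set.Icc (a i) (b i)) ∧
    (∀ i j, i ≠ j → b i < a j ∨ b j < a i) ∧
    (v : ℕ) =
      ((Ps.sum fun P => ((cP P (proj P (γ L)) : ℕ))) +
        (Finset.univ.sum fun i : Fin k =>
          Nat.floor (floorLen PX γ (a i) (b i) / (99 * fr)))) % (n + 1)

/-- The Setup: `X` is a geodesic metric space, tree-graded with respect to `PX`, pieces
do not contain other pieces; `n` is a positive integer, `r > 0` and `f(r) ≥ r`;
`proj P` is the nearest-point projection onto the piece `P`; `x̂` is a base point and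
`x_P = proj P x̂`; `c_P` is a coloring of each piece `P` by `n + 1` colors such that
`r`-components of every nonzero color are `f(r)`-bounded, `r`-components of color `0`
are `8 f(r)`-bounded, and `c_P` vanishes on the closed ball `B(x_P, 2r)`. -/
structure ColoringSetup (X : Type*) [MetricSpace X] (PX : Set (Set X)) (n : ℕ)
    (r fr : ℝ) (xhat : X) (proj : Set X → X → X)
    (cP : Set X → X → Fin (n + 1)) : Prop where
  geodesic : GeodesicSpace X
  treeGraded : IsTreeGraded X PX
  noPieceContainsPiece : ∀ P ∈ PX, ∀ Q ∈ PX, P ⊆ Q → P = Q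
  npos : 0 < n
  rpos : 0 < r
  rlefr : r ≤ fr
  projMem : ∀ P ∈ PX, ∀ x : X, proj P x ∈ P
  projDist : ∀ P ∈ PX, ∀ x : X, dist x (proj P x) = Metric.infDist x P
  ballZero : ∀ P ∈ PX, ∀ y ∈ P, dist y (proj P xhat) ≤ 2 * r → cP P y = 0
  nonzeroBounded : ∀ P ∈ PX, ∀ j : Fin (n + 1), j ≠ 0 →
    ∀ x y : X, IsDChain dist r {z | z ∈ P ∧ cP P z = j} x y → dist x y ≤ fr
  zeroBounded : ∀ P ∈ PX, ∀ x y : X,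
    IsDChain dist r {z | z ∈ P ∧ cP P z = 0} x y → dist x y ≤ 8 * fr

end TreeGradedColoring

section Concat

variable {X : Type*}

/-- The path following `f` up to time `t`, and then `g` from its time `s` on. -/
noncomputable def concatPath (f g : ℝ → X) (t s : ℝ) : ℝ → X :=
  fun x => if x ≤ t then f x else g (x - t + s)

theorem concatPath_of_le {f g : ℝ → X} {t s x : ℝ} (h : x ≤ t) :
    concatPath f g t s x = f x := if_pos h

theorem concatPath_of_ge {f g : ℝ → X} {t s x : ℝ} (hfg : f t = g s) (h : t ≤ x) :
    concatPath f g t s x = g (x - t + s) := by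
  rcases h.eq_or_lt with rfl | h
  · simp [concatPath, hfg]
  · exact if_neg (not_le.mpr h)

end Concat

section Arcs

variable {X : Type*} [MetricSpace X]

theorem exists_isLeast_hit {f : ℝ → X} {a b t₀ : ℝ} {K : Set X}
    (hf : ContinuousOn f (Icc a b)) (hK : IsClosed K) (ht₀ : t₀ ∈ Icc a b) (hmem : f t₀ ∈ K) :
    ∃ t, IsLeast {s | s ∈ Icc a b ∧ f s ∈ K} t :=
  (isCompact_Icc.of_isClosed_subset (hf.preimage_isClosed_of_isClosed isClosed_Icc hK)
    inter_subset_left).exists_isLeast ⟨t₀, ht₀, hmem⟩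

theorem exists_isGreatest_hit {f : ℝ → X} {a b t₀ : ℝ} {K : Set X}
    (hf : ContinuousOn f (Icc a b)) (hK : IsClosed K) (ht₀ : t₀ ∈ Icc a b) (hmem : f t₀ ∈ K) :
    ∃ t, IsGreatest {s | s ∈ Icc a b ∧ f s ∈ K} t :=
  (isCompact_Icc.of_isClosed_subset (hf.preimage_isClosed_of_isClosed isClosed_Icc hK)
    inter_subset_left).exists_isGreatest ⟨t₀, ht₀, hmem⟩

theorem continuousOn_concatPath {f g : ℝ → X} {a t s d : ℝ} (hat : a ≤ t) (hsd : s ≤ d)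
    (hf : ContinuousOn f (Icc a t)) (hg : ContinuousOn g (Icc s d)) (hfg : f t = g s) :
    ContinuousOn (concatPath f g t s) (Icc a (t + (d - s))) := by
  rw [← Icc_union_Icc_eq_Icc hat (by linarith : t ≤ t + (d - s))]
  refine ContinuousOn.union_of_isClosed ?_ ?_ isClosed_Icc isClosed_Icc
  · exact hf.congr fun x hx => concatPath_of_le hx.2
  · have : ContinuousOn (fun x => g (x - t + s)) (Icc t (t + (d - s))) :=
      hg.comp (by fun_prop) fun x hx => ⟨by linarith [hx.1], by linarith [hx.2]⟩
    exact this.congr fun x hx => concatPath_of_ge hfg hx.1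

/-- `u` and `v` are the endpoints of a (possibly degenerate) arc contained in `S`. -/
def ArcJoined (S : Set X) (u v : X) : Prop :=
  ∃ (f : ℝ → X) (a b : ℝ), a ≤ b ∧ ContinuousOn f (Icc a b) ∧ InjOn f (Icc a b) ∧
    f a = u ∧ f b = v ∧ MapsTo f (Icc a b) S

theorem ArcJoined.symm {S : Set X} {u v : X} (h : ArcJoined S u v) : ArcJoined S v u := by
  obtain ⟨f, a, b, hab, hf, hinj, hfa, hfb, hS⟩ := h
  have hmaps : MapsTo (fun x => a + b - x) (Icc a b) (Icc a b) :=
    fun x hx => ⟨by linarith [hx.2], by linarith [hx.1]⟩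
  refine ⟨fun x => f (a + b - x), a, b, hab, hf.comp (by fun_prop) hmaps, ?_, by simpa, by simpa,
    hS.comp hmaps⟩
  intro x hx y hy hxy
  have := hinj (hmaps hx) (hmaps hy) hxy
  simp only at this
  linarith

theorem ArcJoined.trans {S : Set X} {u w v : X} (h₁ : ArcJoined S u w) (h₂ : ArcJoined S w v) :
    ArcJoined S u v := by
  obtain ⟨f, a, b, hab, hf, hfinj, hfa, hfb, hfS⟩ := h₁
  obtain ⟨g, c, d, hcd, hg, hginj, hgc, hgd, hgS⟩ := h₂
  obtain ⟨t, ⟨ht, s, hs, hst⟩, hmin⟩ := exists_isLeast_hit (K := g '' Icc c d) hf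
    (isCompact_Icc.image_of_continuousOn hg).isClosed (right_mem_Icc.mpr hab)
    ⟨c, left_mem_Icc.mpr hcd, by rw [hgc, hfb]⟩
  have hfs : Icc a t ⊆ Icc a b := Icc_subset_Icc_right ht.2
  have hgs : Icc s d ⊆ Icc c d := Icc_subset_Icc_left hs.1
  have hshift : ∀ x ∈ Icc a (t + (d - s)), t ≤ x → x - t + s ∈ Icc c d :=
    fun x hx h => ⟨by linarith [hs.1], by linarith [hx.2]⟩
  have hcross : ∀ x ∈ Icc a (t + (d - s)), ∀ y ∈ Icc a (t + (d - s)), x ≤ t → t ≤ y →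
      f x = g (y - t + s) → x = y := by
    intro x hx y hy hxt hty h
    have htx : t ≤ x := hmin ⟨⟨hx.1, hxt.trans ht.2⟩, _, hshift y hy hty, h.symm⟩
    obtain rfl := le_antisymm hxt htx
    have := hginj hs (hshift y hy hty) (hst.trans h)
    linarith
  refine ⟨concatPath f g t s, a, t + (d - s), by linarith [ht.1, hs.2],
    continuousOn_concatPath ht.1 hs.2 (hf.mono hfs) (hg.mono hgs) hst.symm, ?_, ?_, ?_, ?_⟩
  · intro x hx y hy hxy
    rcases le_total x t with hxt | hxt <;> rcases le_total y t with hyt | hyt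
    · rw [concatPath_of_le hxt, concatPath_of_le hyt] at hxy
      exact hfinj (hfs ⟨hx.1, hxt⟩) (hfs ⟨hy.1, hyt⟩) hxy
    · rw [concatPath_of_le hxt, concatPath_of_ge hst.symm hyt] at hxy
      exact hcross x hx y hy hxt hyt hxy
    · rw [concatPath_of_le hyt, concatPath_of_ge hst.symm hxt] at hxy
      exact (hcross y hy x hx hyt hxt hxy.symm).symm
    · rw [concatPath_of_ge hst.symm hxt, concatPath_of_ge hst.symm hyt] at hxy
      have := hginj (hshift x hx hxt) (hshift y hy hyt) hxy
      linarith
  · rw [concatPath_of_le ht.1, hfa]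
  · rw [concatPath_of_ge hst.symm (by linarith [hs.2]), ← hgd]
    congr 1
    ring
  · intro x hx
    rcases le_total x t with hxt | hxt
    · rw [concatPath_of_le hxt]
      exact hfS (hfs ⟨hx.1, hxt⟩)
    · rw [concatPath_of_ge hst.symm hxt]
      exact hgS (hshift x hx hxt)

end Arcs

section Geodesics

variable {X : Type*} [MetricSpace X]

theorem IsGeodesicSegment.continuousOn {γ : ℝ → X} {a b : ℝ} (h : IsGeodesicSegment γ a b) :
    ContinuousOn γ (Icc a b) :=
  (LipschitzOnWith.of_dist_le_mul (K := 1) fun s hs t ht => by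
    simp [h s hs t ht, Real.dist_eq]).continuousOn

theorem IsGeodesicSegment.injOn {γ : ℝ → X} {a b : ℝ} (h : IsGeodesicSegment γ a b) :
    InjOn γ (Icc a b) := by
  intro s hs t ht hst
  have := h s hs t ht
  rw [hst, dist_self, eq_comm, abs_eq_zero] at this
  linarith

theorem IsGeodesicSegment.mono {γ : ℝ → X} {a b c d : ℝ} (h : IsGeodesicSegment γ a b)
    (hsub : Icc c d ⊆ Icc a b) : IsGeodesicSegment γ c d :=
  fun s hs t ht => h s (hsub hs) t (hsub ht)

theorem IsGeodesicSegment.reverse {γ : ℝ → X} {L : ℝ} (h : IsGeodesicSegment γ 0 L) :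
    IsGeodesicSegment (fun t => γ (L - t)) 0 L := by
  intro s hs t ht
  simp only
  rw [h _ ⟨by linarith [hs.2], by linarith [hs.1]⟩ _ ⟨by linarith [ht.2], by linarith [ht.1]⟩,
    abs_sub_comm]
  congr 1
  ring

theorem IsGeodesicSegment.dist_left {γ : ℝ → X} {L t : ℝ} (h : IsGeodesicSegment γ 0 L)
    (ht : t ∈ Icc 0 L) : dist (γ 0) (γ t) = t := by
  rw [h 0 ⟨le_rfl, ht.1.trans ht.2⟩ t ht, zero_sub, abs_neg, abs_of_nonneg ht.1]

theorem IsGeodesicSegment.arcJoined {γ : ℝ → X} {a b : ℝ} {S : Set X}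
    (h : IsGeodesicSegment γ a b) (hab : a ≤ b) (hS : MapsTo γ (Icc a b) S) :
    ArcJoined S (γ a) (γ b) :=
  ⟨γ, a, b, hab, h.continuousOn, h.injOn, rfl, rfl, hS⟩

end Geodesics

section TreeGraded

variable {X : Type*} [MetricSpace X] {PX : Set (Set X)}

theorem IsTreeGraded.loop_subset_piece (hT : IsTreeGraded X PX) {f : ℝ → X} {a c : ℝ}
    (hac : a < c) (hf : ContinuousOn f (Icc a c)) (hclosed : f a = f c)
    (hinj : InjOn f (Ico a c)) : ∃ P ∈ PX, MapsTo f (Icc a c) P := by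
  have hpos : 0 < c - a := sub_pos.mpr hac
  set g : ℝ → X := fun t => f (a + t * (c - a)) with hg
  have hgc : ContinuousOn g (Icc 0 1) := hf.comp (by fun_prop) fun t ht =>
    ⟨by nlinarith [ht.1], by nlinarith [ht.2]⟩
  have hmaps : ∀ t ∈ Ico (0 : ℝ) 1, a + t * (c - a) ∈ Ico a c := fun t ht =>
    ⟨by nlinarith [ht.1], by nlinarith [ht.2]⟩
  have hrep : ∀ z : AddCircle (1 : ℝ), ∃ t ∈ Ico (0 : ℝ) 1, (t : AddCircle (1 : ℝ)) = z := by
    intro z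
    have : Fact ((0 : ℝ) < 1) := ⟨one_pos⟩
    have hz := (AddCircle.equivIco (1 : ℝ) 0 z).2
    exact ⟨_, ⟨hz.1, hz.2.trans_eq (zero_add 1)⟩, AddCircle.coe_equivIco⟩
  obtain ⟨P, hP, hsub⟩ := hT.t2 (AddCircle.liftIco (1 : ℝ) 0 g)
    (AddCircle.liftIco_zero_continuous (by simp [hg, hclosed]) hgc) (by
      intro z w hzw
      obtain ⟨t, ht, rfl⟩ := hrep z
      obtain ⟨s, hs, rfl⟩ := hrep w
      rw [AddCircle.liftIco_zero_coe_apply ht, AddCircle.liftIco_zero_coe_apply hs] at hzw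
      have := hinj (hmaps t ht) (hmaps s hs) hzw
      rw [mul_right_cancel₀ hpos.ne' (add_left_cancel this)])
  refine ⟨P, hP, ?_⟩
  have hIco : ∀ x ∈ Ico a c, f x ∈ P := by
    intro x hx
    have ht : (x - a) / (c - a) ∈ Ico (0 : ℝ) 1 :=
      ⟨div_nonneg (by linarith [hx.1]) hpos.le, (div_lt_one hpos).mpr (by linarith [hx.2])⟩
    have hval := AddCircle.liftIco_zero_coe_apply (p := (1 : ℝ)) (f := g) ht
    have hgx : g ((x - a) / (c - a)) = f x := by
      simp only [hg, div_mul_cancel₀ _ hpos.ne', add_sub_cancel]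
    rw [← hgx, ← hval]
    exact hsub (mem_range_self _)
  intro x hx
  rcases hx.2.eq_or_lt with rfl | hlt
  · rw [← hclosed]
    exact hIco a ⟨le_rfl, hac⟩
  · exact hIco x ⟨hx.1, hlt⟩

theorem IsTreeGraded.arc_subset_piece (hT : IsTreeGraded X PX) {P : Set X} (hP : P ∈ PX)
    {f : ℝ → X} {a b : ℝ} (hf : ContinuousOn f (Icc a b)) (hinj : InjOn f (Icc a b))
    (ha : f a ∈ P) (hb : f b ∈ P) : MapsTo f (Icc a b) P := by
  intro t ht
  by_contra htP
  have hl : Icc a t ⊆ Icc a b := Icc_subset_Icc_right ht.2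
  have hr : Icc t b ⊆ Icc a b := Icc_subset_Icc_left ht.1
  obtain ⟨s₁, ⟨hs₁, hs₁P⟩, hmax⟩ := exists_isGreatest_hit (hf.mono hl) (hT.closed P hP)
    (left_mem_Icc.mpr ht.1) ha
  obtain ⟨s₂, ⟨hs₂, hs₂P⟩, hmin⟩ := exists_isLeast_hit (hf.mono hr) (hT.closed P hP)
    (right_mem_Icc.mpr ht.2) hb
  have h₁t : s₁ < t := hs₁.2.lt_of_ne fun h => htP (h ▸ hs₁P)
  have ht₂ : t < s₂ := hs₂.1.lt_of_ne fun h => htP (h ▸ hs₂P)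
  have hgap : ∀ s ∈ Icc s₁ s₂, f s ∈ P → s = s₁ ∨ s = s₂ := by
    intro s hs hsP
    rcases le_total s t with h | h
    · exact Or.inl (le_antisymm (hmax ⟨⟨hs₁.1.trans hs.1, h⟩, hsP⟩) hs.1)
    · exact Or.inr (le_antisymm hs.2 (hmin ⟨⟨h, hs.2.trans hs₂.2⟩, hsP⟩))
  have hsub : Icc s₁ s₂ ⊆ Icc a b := Icc_subset_Icc hs₁.1 hs₂.2
  have hne : f s₁ ≠ f s₂ := fun h => by
    have := hinj (hl hs₁) (hr hs₂) h
    linarith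
  obtain ⟨g, hg, hg0, hgd, hgP⟩ := hT.geodesicSub P hP _ hs₂P _ hs₁P
  set d := dist (f s₂) (f s₁) with hd
  have hdpos : 0 < d := dist_pos.mpr hne.symm
  have hcross : ∀ x ∈ Icc s₁ s₂, ∀ y ∈ Ico s₂ (s₂ + d), f x = g (y - s₂ + 0) → x = y := by
    intro x hx y hy hxy
    have hym : y - s₂ + 0 ∈ Icc 0 d := ⟨by linarith [hy.1], by linarith [hy.2]⟩
    rcases hgap x hx (hxy ▸ hgP _ hym) with rfl | rfl
    · rw [← hgd] at hxy
      have := hg.injOn ⟨hdpos.le, le_rfl⟩ hym hxy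
      linarith [hy.2]
    · rw [← hg0] at hxy
      have := hg.injOn ⟨le_rfl, hdpos.le⟩ hym hxy
      linarith
  obtain ⟨Q, hQ, hsubQ⟩ := hT.loop_subset_piece (f := concatPath f g s₂ 0) (a := s₁)
    (c := s₂ + (d - 0)) (by linarith)
    (continuousOn_concatPath (by linarith) hdpos.le (hf.mono hsub) hg.continuousOn hg0.symm)
    (by
      rw [concatPath_of_le (by linarith), concatPath_of_ge hg0.symm (by linarith), ← hgd]
      congr 1
      ring)
    (by
      rw [sub_zero]
      intro x hx y hy hxy
      rcases le_total x s₂ with hxt | hxt <;> rcases le_total y s₂ with hyt | hyt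
      · rw [concatPath_of_le hxt, concatPath_of_le hyt] at hxy
        exact hinj (hsub ⟨hx.1, hxt⟩) (hsub ⟨hy.1, hyt⟩) hxy
      · rw [concatPath_of_le hxt, concatPath_of_ge hg0.symm hyt] at hxy
        exact hcross x ⟨hx.1, hxt⟩ y ⟨hyt, hy.2⟩ hxy
      · rw [concatPath_of_le hyt, concatPath_of_ge hg0.symm hxt] at hxy
        exact (hcross y ⟨hy.1, hyt⟩ x ⟨hxt, hx.2⟩ hxy.symm).symm
      · rw [concatPath_of_ge hg0.symm hxt, concatPath_of_ge hg0.symm hyt] at hxy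
        have := hg.injOn ⟨by linarith, by linarith [hx.2]⟩ ⟨by linarith, by linarith [hy.2]⟩ hxy
        linarith)
  have hfQ : ∀ x ∈ Icc s₁ s₂, f x ∈ Q := fun x hx => by
    rw [← concatPath_of_le (f := f) (g := g) (s := 0) hx.2]
    exact hsubQ ⟨hx.1, by linarith [hx.2]⟩
  have hQP : Q = P := by
    by_contra h
    exact hne (hT.t1 Q hQ P hP h ⟨hfQ s₁ ⟨le_rfl, by linarith⟩, hs₁P⟩
      ⟨hfQ s₂ ⟨by linarith, le_rfl⟩, hs₂P⟩)
  exact htP (hQP ▸ hfQ t ⟨h₁t.le, ht₂.le⟩)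

theorem IsTreeGraded.eq_of_arcJoined (hT : IsTreeGraded X PX) {P : Set X} (hP : P ∈ PX)
    {S : Set X} {u v : X} (h : ArcJoined S u v) (hu : u ∈ P) (hv : v ∈ P)
    (hS : ∀ y ∈ S, y ∈ P → y = u ∨ y = v) : u = v := by
  obtain ⟨f, a, b, hab, hf, hinj, rfl, rfl, hfS⟩ := h
  rcases hab.eq_or_lt with rfl | hlt
  · rfl
  have hm : (a + b) / 2 ∈ Icc a b := ⟨by linarith, by linarith⟩
  rcases hS _ (hfS hm) (hT.arc_subset_piece hP hf hinj hu hv hm) with h | h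
  · have := hinj hm ⟨le_rfl, hab⟩ h
    linarith
  · have := hinj hm ⟨hab, le_rfl⟩ h
    linarith

/-- A geodesic whose endpoints have different nearest points `u`, `v` on a piece passes
through `u`. -/
theorem IsTreeGraded.exists_eq_nearest (hT : IsTreeGraded X PX) (hX : GeodesicSpace X)
    {P : Set X} (hP : P ∈ PX) {γ : ℝ → X} {L : ℝ} (hL : 0 ≤ L) (hγ : IsGeodesicSegment γ 0 L)
    {u v : X} (hu : u ∈ P) (hv : v ∈ P) (hud : dist (γ 0) u = infDist (γ 0) P)
    (hvd : dist (γ L) v = infDist (γ L) P) (huv : u ≠ v) : ∃ t ∈ Icc 0 L, γ t = u := by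
  have hnear : ∀ y w : X, dist y w = infDist y P →
      ∃ S : Set X, ArcJoined S y w ∧ ∀ z ∈ S, z ∈ P → z = w := by
    intro y w hyw
    obtain ⟨g, hg, hg0, hgd⟩ := hX y w
    refine ⟨g '' Icc 0 (dist y w), ?_, ?_⟩
    · have := hg.arcJoined dist_nonneg (mapsTo_image g _)
      rwa [hg0, hgd] at this
    · rintro _ ⟨s, hs, rfl⟩ hsP
      have h1 : dist y w ≤ dist y (g s) := hyw ▸ infDist_le_dist_of_mem hsP
      rw [← hg0, hg 0 ⟨le_rfl, dist_nonneg⟩ s hs, zero_sub, abs_neg, abs_of_nonneg hs.1, hg0] at h1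
      rw [le_antisymm hs.2 h1, hgd]
  obtain ⟨S₁, hS₁, hS₁P⟩ := hnear _ _ hud
  obtain ⟨S₂, hS₂, hS₂P⟩ := hnear _ _ hvd
  have hmono : ∀ {S S' : Set X} {y w : X}, ArcJoined S y w → S ⊆ S' → ArcJoined S' y w := by
    rintro S S' y w ⟨f, a, b, h₁, h₂, h₃, h₄, h₅, h₆⟩ hSS'
    exact ⟨f, a, b, h₁, h₂, h₃, h₄, h₅, h₆.mono_right hSS'⟩
  by_cases hmeet : ∃ t ∈ Icc 0 L, γ t ∈ P
  · obtain ⟨t₀, ht₀, ht₀P⟩ := hmeet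
    obtain ⟨t, ⟨ht, htP⟩, hmin⟩ :=
      exists_isLeast_hit hγ.continuousOn (hT.closed P hP) ht₀ ht₀P
    have harc : ArcJoined (γ '' Icc 0 t) (γ 0) (γ t) :=
      (hγ.mono (Icc_subset_Icc_right ht.2)).arcJoined ht.1 (mapsTo_image γ _)
    refine ⟨t, ht, (hT.eq_of_arcJoined hP (S := S₁ ∪ γ '' Icc 0 t)
      ((hmono hS₁ subset_union_left).symm.trans (hmono harc subset_union_right)) hu htP ?_).symm⟩
    rintro y (hy | ⟨s, hs, rfl⟩) hyP
    · exact Or.inl (hS₁P y hy hyP)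
    · right
      rw [le_antisymm hs.2 (hmin ⟨⟨hs.1, hs.2.trans ht.2⟩, hyP⟩)]
  · refine absurd (hT.eq_of_arcJoined hP (S := S₁ ∪ (γ '' Icc 0 L ∪ S₂))
      ((hmono hS₁ subset_union_left).symm.trans
        ((hmono (hγ.arcJoined hL (mapsTo_image γ _)) (subset_union_left.trans
          subset_union_right)).trans
        (hmono hS₂ (subset_union_right.trans subset_union_right)))) hu hv ?_) huv
    rintro y (hy | ⟨s, hs, rfl⟩ | hy) hyP
    · exact Or.inl (hS₁P y hy hyP)
    · exact absurd ⟨s, hs, hyP⟩ hmeet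
    · exact Or.inr (hS₂P y hy hyP)

end TreeGraded

section Intervals

/-- `S` is a finite union of compact intervals, pairwise separated by gaps. -/
def IsSeparatedIccUnion (S : Set ℝ) : Prop :=
  ∃ (ι : Type) (_ : Fintype ι) (a b : ι → ℝ), (∀ i, a i ≤ b i) ∧
    S = ⋃ i, Icc (a i) (b i) ∧ ∀ i j, i ≠ j → b i < a j ∨ b j < a i

theorem isSeparatedIccUnion_Icc {a b : ℝ} (hab : a ≤ b) : IsSeparatedIccUnion (Icc a b) :=
  ⟨Unit, inferInstance, fun _ => a, fun _ => b, fun _ => hab, by simp [iUnion_const],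
    fun i j h => absurd (Subsingleton.elim i j) h⟩

theorem IsSeparatedIccUnion.diff_Ioo {S : Set ℝ} (hS : IsSeparatedIccUnion S) (p q : ℝ) :
    IsSeparatedIccUnion (S \ Ioo p q) := by
  rcases le_or_gt q p with hqp | hpq
  · rwa [Ioo_eq_empty (not_lt.mpr hqp), sdiff_empty]
  classical
  obtain ⟨ι, _, a, b, -, rfl, hsep⟩ := hS
  let lo : ι × Bool → ℝ := fun x => if x.2 then max (a x.1) q else a x.1
  let hi : ι × Bool → ℝ := fun x => if x.2 then b x.1 else min (b x.1) p
  have hlo : ∀ x, a x.1 ≤ lo x := by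
    rintro ⟨i, _ | _⟩ <;> simp [lo]
  have hhi : ∀ x, hi x ≤ b x.1 := by
    rintro ⟨i, _ | _⟩ <;> simp [hi]
  refine ⟨{x : ι × Bool // lo x ≤ hi x}, inferInstance, fun x => lo x, fun x => hi x,
    fun x => x.2, ?_, ?_⟩
  · ext t
    simp only [mem_sdiff, mem_iUnion, mem_Icc, mem_Ioo, not_and, not_lt]
    constructor
    · rintro ⟨⟨i, hi₁, hi₂⟩, h⟩
      rcases le_or_gt t p with htp | hpt
      · have h₁ : lo (i, false) ≤ t := by simpa [lo] using hi₁
        have h₂ : t ≤ hi (i, false) := by simpa [hi] using ⟨hi₂, htp⟩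
        exact ⟨⟨(i, false), h₁.trans h₂⟩, h₁, h₂⟩
      · have h₁ : lo (i, true) ≤ t := by simpa [lo] using ⟨hi₁, h hpt⟩
        have h₂ : t ≤ hi (i, true) := by simpa [hi] using hi₂
        exact ⟨⟨(i, true), h₁.trans h₂⟩, h₁, h₂⟩
    · rintro ⟨⟨x, hx⟩, h₁, h₂⟩
      refine ⟨⟨x.1, (hlo x).trans h₁, h₂.trans (hhi x)⟩, fun hpt => ?_⟩
      obtain ⟨i, _ | _⟩ := x
      · have : t ≤ min (b i) p := by simpa [hi] using h₂
        exact absurd (this.trans (min_le_right _ _)) (not_le.mpr hpt)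
      · have : max (a i) q ≤ t := by simpa [lo] using h₁
        exact (le_max_right _ _).trans this
  · rintro ⟨⟨i, c⟩, hx⟩ ⟨⟨j, d⟩, hy⟩ hne
    by_cases hij : i = j
    · subst hij
      cases c <;> cases d
      · exact absurd rfl hne
      · left
        simpa [lo, hi] using Or.inr (Or.inr hpq)
      · right
        simpa [lo, hi] using Or.inr (Or.inr hpq)
      · exact absurd rfl hne
    · exact (hsep i j hij).imp (fun h => ((hhi (i, c)).trans_lt h).trans_le (hlo (j, d)))
        fun h => ((hhi (j, d)).trans_lt h).trans_le (hlo (i, c))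

theorem IsSeparatedIccUnion.diff_biUnion_Ioo {S : Set ℝ} (hS : IsSeparatedIccUnion S)
    {κ : Type*} {F : Set κ} (hF : F.Finite) (p q : κ → ℝ) :
    IsSeparatedIccUnion (S \ ⋃ k ∈ F, Ioo (p k) (q k)) := by
  induction F, hF using Set.Finite.induction_on with
  | empty => simpa using hS
  | @insert k F _ _ ih =>
    rw [biUnion_insert, union_comm, ← sdiff_sdiff]
    exact ih.diff_Ioo _ _

theorem IsSeparatedIccUnion.exists_fin {S : Set ℝ} (hS : IsSeparatedIccUnion S) :
    ∃ (k : ℕ) (a b : Fin k → ℝ), (∀ i, a i ≤ b i) ∧ S = ⋃ i, Icc (a i) (b i) ∧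
      ∀ i j, i ≠ j → b i < a j ∨ b j < a i := by
  obtain ⟨ι, _, a, b, hab, rfl, hsep⟩ := hS
  let e := (Fintype.equivFin ι).symm
  exact ⟨Fintype.card ι, a ∘ e, b ∘ e, fun i => hab _,
    (e.surjective.iUnion_comp fun i => Icc (a i) (b i)).symm,
    fun i j h => hsep _ _ (e.injective.ne h)⟩

end Intervals

section Coloring

variable {X : Type*} [MetricSpace X] {PX : Set (Set X)} {n : ℕ} {r fr : ℝ} {xhat : X}
  {proj : Set X → X → X} {cP : Set X → X → Fin (n + 1)}

theorem ColoringSetup.dist_proj_le (hs : ColoringSetup X PX n r fr xhat proj cP) {P : Set X}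
    (hP : P ∈ PX) (x : X) {y : X} (hy : y ∈ P) : dist x (proj P x) ≤ dist x y :=
  hs.projDist P hP x ▸ infDist_le_dist_of_mem hy

/-- A geodesic from `x̂` crosses a piece on which its endpoints have different projections
exactly from one projection to the other. -/
theorem ColoringSetup.crossing (hs : ColoringSetup X PX n r fr xhat proj cP) {P : Set X}
    (hP : P ∈ PX) {γ : ℝ → X} {L : ℝ} (hL : 0 ≤ L) (hγ : IsGeodesicSegment γ 0 L)
    (h0 : γ 0 = xhat) (hne : proj P xhat ≠ proj P (γ L)) :
    dist xhat (proj P xhat) + dist (proj P xhat) (proj P (γ L)) =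
        L - dist (γ L) (proj P (γ L)) ∧
      ∀ t ∈ Icc 0 L, γ t ∈ P ↔
        t ∈ Icc (dist xhat (proj P xhat)) (L - dist (γ L) (proj P (γ L))) := by
  have hT := hs.treeGraded
  have hdist : ∀ z w : X, proj P z ≠ proj P w → ∀ η : ℝ → X, IsGeodesicSegment η 0 L →
      η 0 = z → η L = w → dist z (proj P z) ∈ Icc 0 L ∧ η (dist z (proj P z)) = proj P z := by
    rintro z w hzw η hη rfl rfl
    obtain ⟨t, ht, hts⟩ := hT.exists_eq_nearest hs.geodesic hP hL hη (hs.projMem P hP _)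
      (hs.projMem P hP _) (hs.projDist P hP _) (hs.projDist P hP _) hzw
    have : dist (η 0) (proj P (η 0)) = t := by
      rw [← hts, hη.dist_left ht]
    exact this ▸ ⟨ht, hts⟩
  obtain ⟨hs₁, hs₂⟩ := hdist _ _ hne γ hγ h0 rfl
  obtain ⟨he₁, he₂⟩ := hdist _ _ hne.symm _ hγ.reverse (by simp) (by simpa using h0)
  set s := dist xhat (proj P xhat)
  set e := dist (γ L) (proj P (γ L))
  have heI : L - e ∈ Icc 0 L := ⟨by linarith [he₁.2], by linarith [he₁.1]⟩
  have hbound : ∀ t ∈ Icc 0 L, γ t ∈ P → s ≤ t ∧ t ≤ L - e := by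
    intro t ht htP
    have h₁ := hs.dist_proj_le hP xhat htP
    have h₂ := hs.dist_proj_le hP (γ L) htP
    rw [show dist xhat (γ t) = t from h0 ▸ hγ.dist_left ht] at h₁
    rw [hγ L ⟨hL, le_rfl⟩ t ht, abs_of_nonneg (by linarith [ht.2])] at h₂
    exact ⟨h₁, by linarith⟩
  have hsP : γ s ∈ P := hs₂ ▸ hs.projMem P hP _
  have heP : γ (L - e) ∈ P := he₂ ▸ hs.projMem P hP _
  refine ⟨?_, fun t ht => ⟨hbound t ht, fun h => ?_⟩⟩
  · rw [← hs₂, ← he₂, hγ s hs₁ _ heI, abs_sub_comm,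
      abs_of_nonneg (by linarith [(hbound s hs₁ hsP).2])]
    ring
  · have hsub : Icc s (L - e) ⊆ Icc 0 L := Icc_subset_Icc hs₁.1 heI.2
    exact hT.arc_subset_piece hP (hγ.continuousOn.mono hsub) (hγ.injOn.mono hsub) hsP heP h

/-- The pieces on which `x̂` and `x` have projections at distance more than `2 r`. -/
def farPieces (PX : Set (Set X)) (r : ℝ) (xhat : X) (proj : Set X → X → X) (x : X) :
    Set (Set X) :=
  {P | P ∈ PX ∧ 2 * r < dist (proj P xhat) (proj P x)}

theorem ColoringSetup.finite_farPieces (hs : ColoringSetup X PX n r fr xhat proj cP) (x : X) :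
    (farPieces PX r xhat proj x).Finite := by
  obtain ⟨γ, hγ, h0, hx⟩ := hs.geodesic xhat x
  set L := dist xhat x
  have hr := hs.rpos
  have hcross := fun P (hP : P ∈ farPieces PX r xhat proj x) =>
    hs.crossing hP.1 dist_nonneg hγ h0
      (by rw [hx]; exact dist_pos.mp (by linarith [hP.2]))
  rw [hx] at hcross
  have hlt : ∀ P ∈ farPieces PX r xhat proj x, ∀ Q ∈ farPieces PX r xhat proj x, P ≠ Q →
      dist xhat (proj P xhat) ≤ dist xhat (proj Q xhat) →
      dist xhat (proj P xhat) + 2 * r ≤ dist xhat (proj Q xhat) := by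
    intro P hP Q hQ hPQ hle
    by_contra! hcon
    obtain ⟨hP₁, hP₂⟩ := hcross P hP
    obtain ⟨hQ₁, hQ₂⟩ := hcross Q hQ
    have hPfar := hP.2
    have hQfar := hQ.2
    have hPx : 0 ≤ dist x (proj P x) := dist_nonneg
    have hQx : 0 ≤ dist x (proj Q x) := dist_nonneg
    have hQh : 0 ≤ dist xhat (proj Q xhat) := dist_nonneg
    set m := min (L - dist x (proj P x)) (L - dist x (proj Q x)) with hm
    have hlo : dist xhat (proj Q xhat) < m := lt_min (by linarith) (by linarith)
    have hmP : m ≤ L - dist x (proj P x) := min_le_left _ _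
    have hmQ : m ≤ L - dist x (proj Q x) := min_le_right _ _
    have hI₁ : dist xhat (proj Q xhat) ∈ Icc 0 L := ⟨hQh, by linarith⟩
    have hI₂ : m ∈ Icc 0 L := ⟨by linarith, by linarith⟩
    have := hγ.injOn hI₁ hI₂ (hs.treeGraded.t1 P hP.1 Q hQ.1 hPQ
      ⟨(hP₂ _ hI₁).2 ⟨hle, by linarith⟩, (hQ₂ _ hI₁).2 ⟨le_rfl, by linarith⟩⟩
      ⟨(hP₂ _ hI₂).2 ⟨by linarith, hmP⟩, (hQ₂ _ hI₂).2 ⟨hlo.le, hmQ⟩⟩)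
    linarith
  let N : Set X → ℕ := fun P => ⌊dist xhat (proj P xhat) / (2 * r)⌋₊
  have hstep : ∀ P ∈ farPieces PX r xhat proj x, ∀ Q ∈ farPieces PX r xhat proj x, P ≠ Q →
      dist xhat (proj P xhat) ≤ dist xhat (proj Q xhat) → N P ≠ N Q := by
    intro P hP Q hQ hPQ hle hN
    have h := hlt P hP Q hQ hPQ hle
    have h₁ : dist xhat (proj P xhat) / (2 * r) + 1 ≤ dist xhat (proj Q xhat) / (2 * r) := by
      rw [← div_self (by linarith : 2 * r ≠ 0), ← add_div]
      exact div_le_div_of_nonneg_right h (by linarith)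
    have h₂ := Nat.floor_mono h₁
    rw [Nat.floor_add_one (by positivity)] at h₂
    simp only [N] at hN
    omega
  refine Finite.of_finite_image ((finite_Iic ⌊L / (2 * r)⌋₊).subset ?_) (f := N) ?_
  · rintro _ ⟨P, hP, rfl⟩
    have h := (hcross P hP).1
    refine Nat.floor_mono (div_le_div_of_nonneg_right ?_ (by linarith))
    have hPx : 0 ≤ dist x (proj P x) := dist_nonneg
    linarith [hP.2]
  · intro P hP Q hQ hN
    by_contra hPQ
    rcases le_total (dist xhat (proj P xhat)) (dist xhat (proj Q xhat)) with h | h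
    · exact hstep P hP Q hQ hPQ h hN
    · exact hstep Q hQ P hP (Ne.symm hPQ) h hN.symm

theorem ColoringSetup.mem_pieceComp (hs : ColoringSetup X PX n r fr xhat proj cP) {P : Set X}
    (hP : P ∈ PX) {y : X} (hy : y ∈ P) (hd : dist (proj P xhat) y ≤ 2 * r) :
    y ∈ pieceComp r xhat proj cP P := by
  obtain ⟨g, hg, hg0, hgd, hgP⟩ := hs.treeGraded.geodesicSub P hP _ (hs.projMem P hP xhat) y hy
  set d := dist (proj P xhat) y
  have hd0 : 0 ≤ d := dist_nonneg
  have hr := hs.rpos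
  have hI : ∀ i : ℕ, i ≤ 5 → (i : ℝ) * (d / 5) ∈ Icc 0 d := by
    intro i hi
    have : (i : ℝ) ≤ 5 := by exact_mod_cast hi
    exact ⟨by positivity, by nlinarith⟩
  refine ⟨5, fun i => g (i * (d / 5)), by simpa using hg0, ?_, fun i hi => ?_, fun i hi => ?_⟩
  · rw [← hgd]
    exact congrArg g (by push_cast; ring)
  · have hi' := hI i hi
    refine ⟨hgP _ hi', hs.ballZero P hP _ (hgP _ hi') ?_⟩
    rw [← hg0, hg _ hi' 0 ⟨le_rfl, hd0⟩, sub_zero, abs_of_nonneg hi'.1]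
    exact hi'.2.trans hd
  · rw [hg _ (hI i hi.le) _ (hI (i + 1) hi), abs_sub_comm]
    push_cast
    rw [show ((i : ℝ) + 1) * (d / 5) - i * (d / 5) = d / 5 by ring, abs_of_nonneg (by positivity)]
    linarith

theorem ColoringSetup.color_ne_zero_subset (hs : ColoringSetup X PX n r fr xhat proj cP) (x : X) :
    {P : Set X | P ∈ PX ∧ cP P (proj P x) ≠ 0} ⊆ farPieces PX r xhat proj x := by
  rintro P ⟨hP, hne⟩
  refine ⟨hP, ?_⟩
  by_contra! h
  exact hne (hs.ballZero P hP _ (hs.projMem P hP x) (by rwa [dist_comm]))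

theorem ColoringSetup.mem_farPieces_of_notMem_pieceComp
    (hs : ColoringSetup X PX n r fr xhat proj cP) {P : Set X} (hP : P ∈ PX) {x : X}
    (h : proj P x ∉ pieceComp r xhat proj cP P) : P ∈ farPieces PX r xhat proj x :=
  ⟨hP, not_le.mp fun hle => h (hs.mem_pieceComp hP (hs.projMem P hP x) hle)⟩

theorem ColoringSetup.ne_of_mem_farPieces (hs : ColoringSetup X PX n r fr xhat proj cP)
    {P : Set X} {x : X} (h : P ∈ farPieces PX r xhat proj x) : proj P xhat ≠ proj P x :=
  dist_pos.mp (by linarith [h.2, hs.rpos])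

/-- The parameters of a geodesic from `x̂` to `γ L` in a piece separating its endpoints. -/
theorem ColoringSetup.setOf_mem_piece (hs : ColoringSetup X PX n r fr xhat proj cP) {P : Set X}
    (hP : P ∈ PX) {γ : ℝ → X} {L : ℝ} (hL : 0 ≤ L) (hγ : IsGeodesicSegment γ 0 L)
    (h0 : γ 0 = xhat) (hne : proj P xhat ≠ proj P (γ L)) :
    {t | t ∈ Icc 0 L ∧ γ t ∈ P} =
      Icc (dist xhat (proj P xhat)) (L - dist (γ L) (proj P (γ L))) := by
  obtain ⟨-, h⟩ := hs.crossing hP hL hγ h0 hne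
  ext t
  constructor
  · exact fun ht => (h t ht.1).1 ht.2
  · intro ht
    have htI : t ∈ Icc 0 L := ⟨dist_nonneg.trans ht.1, ht.2.trans (sub_le_self _ dist_nonneg)⟩
    exact ⟨htI, (h t htI).2 ht⟩

theorem ColoringSetup.isLongPiece_iff (hs : ColoringSetup X PX n r fr xhat proj cP)
    {γ : ℝ → X} {L : ℝ} (hL : 0 ≤ L) (hγ : IsGeodesicSegment γ 0 L) (h0 : γ 0 = xhat)
    (P : Set X) : IsLongPiece PX r xhat proj cP γ L P ↔
      P ∈ PX ∧ proj P (γ L) ∉ pieceComp r xhat proj cP P := by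
  refine ⟨fun h => ⟨h.1, h.2.2⟩, fun h => ⟨h.1, ?_, h.2⟩⟩
  have hne := hs.ne_of_mem_farPieces (hs.mem_farPieces_of_notMem_pieceComp h.1 h.2)
  have hmem : dist xhat (proj P xhat) ∈ {t | t ∈ Icc 0 L ∧ γ t ∈ P} := by
    rw [hs.setOf_mem_piece h.1 hL hγ h0 hne]
    have h₁ := (hs.crossing h.1 hL hγ h0 hne).1
    have h₂ : 0 ≤ dist (proj P xhat) (proj P (γ L)) := dist_nonneg
    exact ⟨le_rfl, by linarith⟩
  exact ⟨_, hmem⟩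

theorem ColoringSetup.finite_isLongPiece (hs : ColoringSetup X PX n r fr xhat proj cP)
    (γ : ℝ → X) (L : ℝ) : {P : Set X | IsLongPiece PX r xhat proj cP γ L P}.Finite :=
  (hs.finite_farPieces (γ L)).subset fun _ h => hs.mem_farPieces_of_notMem_pieceComp h.1 h.2.2

theorem ColoringSetup.betaSet_congr (hs : ColoringSetup X PX n r fr xhat proj cP)
    {γ γ' : ℝ → X} {L : ℝ} (hL : 0 ≤ L) (hγ : IsGeodesicSegment γ 0 L) (h0 : γ 0 = xhat)
    (hγ' : IsGeodesicSegment γ' 0 L) (h0' : γ' 0 = xhat) (hend : γ L = γ' L) :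
    betaSet PX r xhat proj cP γ L = betaSet PX r xhat proj cP γ' L := by
  have hlong : {P | IsLongPiece PX r xhat proj cP γ L P} =
      {P | IsLongPiece PX r xhat proj cP γ' L P} := by
    ext P
    simp only [mem_ofPred_eq, hs.isLongPiece_iff hL hγ h0, hs.isLongPiece_iff hL hγ' h0', hend]
  unfold betaSet
  rw [hlong]
  refine congrArg _ (iUnion₂_congr fun P hP => ?_)
  have hne := hs.ne_of_mem_farPieces (hs.mem_farPieces_of_notMem_pieceComp hP.1 hP.2.2)
  have : {t | t ∈ Icc 0 L ∧ γ t ∈ P} = {t | t ∈ Icc 0 L ∧ γ' t ∈ P} := by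
    rw [hs.setOf_mem_piece hP.1 hL hγ h0 (hend ▸ hne), hs.setOf_mem_piece hP.1 hL hγ' h0' hne,
      hend]
  simp only [pieceStart, pieceEnd, this]

theorem ColoringSetup.subpath_subset_piece (hs : ColoringSetup X PX n r fr xhat proj cP)
    {γ γ' : ℝ → X} {L : ℝ} (hL : 0 ≤ L) (hγ : IsGeodesicSegment γ 0 L) (h0 : γ 0 = xhat)
    (hγ' : IsGeodesicSegment γ' 0 L) (h0' : γ' 0 = xhat) (hend : γ L = γ' L) {t b : ℝ}
    (ht : 0 ≤ t) (htb : t ≤ b) (hb : b ≤ L) (h : ∃ P ∈ PX, γ '' Icc t b ⊆ P) :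
    ∃ P ∈ PX, γ' '' Icc t b ⊆ P := by
  rcases htb.eq_or_lt with rfl | htb
  · obtain ⟨P, hP, hmem⟩ := hs.treeGraded.covers (γ' t)
    exact ⟨P, hP, by simpa using hmem⟩
  obtain ⟨P, hP, hsub⟩ := h
  refine ⟨P, hP, ?_⟩
  have htP : γ t ∈ P := hsub (mem_image_of_mem _ ⟨le_rfl, htb.le⟩)
  have hbP : γ b ∈ P := hsub (mem_image_of_mem _ ⟨htb.le, le_rfl⟩)
  have htI : t ∈ Icc 0 L := ⟨ht, htb.le.trans hb⟩
  have hbI : b ∈ Icc 0 L := ⟨ht.trans htb.le, hb⟩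
  have hne : proj P xhat ≠ proj P (γ L) := by
    intro heq
    have h₁ := hs.dist_proj_le hP xhat htP
    have h₂ := hs.dist_proj_le hP (γ L) hbP
    rw [hγ L ⟨hL, le_rfl⟩ b hbI, abs_of_nonneg (by linarith)] at h₂
    rw [show dist xhat (γ t) = t from h0 ▸ hγ.dist_left htI] at h₁
    have h₃ := dist_triangle_right xhat (γ L) (proj P (γ L))
    rw [show dist xhat (γ L) = L from h0 ▸ hγ.dist_left ⟨hL, le_rfl⟩, ← heq] at h₃
    rw [← heq] at h₂
    linarith
  have hset : {s | s ∈ Icc 0 L ∧ γ' s ∈ P} = {s | s ∈ Icc 0 L ∧ γ s ∈ P} := by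
    rw [hs.setOf_mem_piece hP hL hγ h0 hne, hs.setOf_mem_piece hP hL hγ' h0' (hend ▸ hne), hend]
  rintro _ ⟨s, hst, rfl⟩
  have hmem : s ∈ {s | s ∈ Icc 0 L ∧ γ s ∈ P} :=
    ⟨⟨ht.trans hst.1, hst.2.trans hb⟩, hsub (mem_image_of_mem _ hst)⟩
  exact (hset.ge hmem).2

theorem ColoringSetup.floorLen_congr (hs : ColoringSetup X PX n r fr xhat proj cP)
    {γ γ' : ℝ → X} {L : ℝ} (hL : 0 ≤ L) (hγ : IsGeodesicSegment γ 0 L) (h0 : γ 0 = xhat)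
    (hγ' : IsGeodesicSegment γ' 0 L) (h0' : γ' 0 = xhat) (hend : γ L = γ' L) {a b : ℝ}
    (ha : 0 ≤ a) (hb : b ≤ L) : floorLen PX γ a b = floorLen PX γ' a b := by
  unfold floorLen
  congr 2
  ext t
  refine and_congr_right fun ht => ⟨?_, ?_⟩
  · exact hs.subpath_subset_piece hL hγ h0 hγ' h0' hend (ha.trans ht.1) ht.2 hb
  · exact hs.subpath_subset_piece hL hγ' h0' hγ h0 hend.symm (ha.trans ht.1) ht.2 hb

theorem ColoringSetup.colorValue_congr (hs : ColoringSetup X PX n r fr xhat proj cP)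
    {γ γ' : ℝ → X} {L : ℝ} (hL : 0 ≤ L) (hγ : IsGeodesicSegment γ 0 L) (h0 : γ 0 = xhat)
    (hγ' : IsGeodesicSegment γ' 0 L) (h0' : γ' 0 = xhat) (hend : γ L = γ' L) {v : Fin (n + 1)}
    (h : ColorValue PX r fr xhat proj cP γ L v) : ColorValue PX r fr xhat proj cP γ' L v := by
  obtain ⟨Ps, k, a, b, hPs, hab, hβ, hsep, hv⟩ := h
  have hsub : ∀ i, Icc (a i) (b i) ⊆ Icc 0 L := fun i =>
    ((subset_iUnion (fun i => Icc (a i) (b i)) i).trans hβ.ge).trans sdiff_subset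
  refine ⟨Ps, k, a, b, hend ▸ hPs, hab, ?_, hsep, ?_⟩
  · rw [← hs.betaSet_congr hL hγ h0 hγ' h0' hend, hβ]
  · rw [hv, hend]
    congr 2
    refine Finset.sum_congr rfl fun i _ => ?_
    rw [hs.floorLen_congr hL hγ h0 hγ' h0' hend (hsub i ⟨le_rfl, hab i⟩).1
      (hsub i ⟨hab i, le_rfl⟩).2]

theorem ColoringSetup.exists_colorValue (hs : ColoringSetup X PX n r fr xhat proj cP)
    {γ : ℝ → X} {L : ℝ} (hL : 0 ≤ L) : ∃ v, ColorValue PX r fr xhat proj cP γ L v := by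
  obtain ⟨k, a, b, hab, hβ, hsep⟩ := ((isSeparatedIccUnion_Icc hL).diff_biUnion_Ioo
    (hs.finite_isLongPiece γ L) (fun P => pieceStart γ L P + r / 2)
    (fun P => pieceEnd γ L P)).exists_fin
  have hfin := (hs.finite_farPieces (γ L)).subset (hs.color_ne_zero_subset (γ L))
  exact ⟨⟨_, Nat.mod_lt _ n.succ_pos⟩, hfin.toFinset, k, a, b, hfin.coe_toFinset, hab, hβ, hsep,
    rfl⟩

end Coloring

/-- In the Setup, for every point `x`: only finitely many pieces contribute a nonzero
term to the sum `Σ_P c_P(π_P x)`; every geodesic `γ` from `x̂` to `x` has only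
finitely many long pieces; and the value `c*_X(x)` computed along a geodesic from `x̂`
to `x` does not depend on the choice of the geodesic. -/
theorem colorValue_welldefined (X : Type*) [MetricSpace X] [CompleteSpace X]
    (PX : Set (Set X)) (n : ℕ) (r fr : ℝ) (xhat : X)
    (proj : Set X → X → X) (cP : Set X → X → Fin (n + 1))
    (hsetup : ColoringSetup X PX n r fr xhat proj cP) (x : X) :
    {P : Set X | P ∈ PX ∧ cP P (proj P x) ≠ 0}.Finite ∧
    (∀ (γ : ℝ → X) (L : ℝ), 0 ≤ L → IsGeodesicSegment γ 0 L → γ 0 = xhat → γ L = x →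
      {P : Set X | IsLongPiece PX r xhat proj cP γ L P}.Finite) ∧
    ∃ v : Fin (n + 1), ∀ (γ : ℝ → X) (L : ℝ), 0 ≤ L → IsGeodesicSegment γ 0 L →
      γ 0 = xhat → γ L = x → ColorValue PX r fr xhat proj cP γ L v := by
  refine ⟨(hsetup.finite_farPieces x).subset (hsetup.color_ne_zero_subset x),
    fun γ L _ _ _ _ => hsetup.finite_isLongPiece γ L, ?_⟩
  obtain ⟨γ₀, hγ₀, h0, hx⟩ := hsetup.geodesic xhat x
  obtain ⟨v, hv⟩ := hsetup.exists_colorValue (γ := γ₀) (dist_nonneg (x := xhat) (y := x))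
  refine ⟨v, fun γ L hL hγ hγ0 hγL => ?_⟩
  have hlen : dist xhat x = L := by
    rw [← hγ0, ← hγL, hγ.dist_left ⟨hL, le_rfl⟩]
  rw [hlen] at hγ₀ hx hv
  exact hsetup.colorValue_congr hL hγ₀ h0 hγ hγ0 (hx.trans hγL.symm) hv
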